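/- Let t, C, l > 0, x ∈ [0,l], and p_{l,t}(x,0) = 2C/(1 − e^{−2Cl}) + e^{Cx − C²t/2}·(2/l)·∑_{n=1}^∞ [f_{t,x}(nπ/l) − g_{t,x}(nπ/l)] with f, g as above. Then p_{l,t}(x,0) ≤ 2C·e^{−2Cl}/(1 − e^{−2Cl}) + (2/√t)·φ(√t·C − x/√t) + 2C·Φ(√t·C − x/√t) + 2·e^{Cx − C²t/2}·(3 + xC)²/(l·t·C²). -/

import Mathlib

open Real

/-- Standard normal density. -/
noncomputable def stdNormalPDF (x : ℝ) : ℝ := Real.exp (-x ^ 2 / 2) / Real.sqrt (2 * Real.pi)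

/-- Standard normal cumulative distribution function. -/
noncomputable def stdNormalCDF (x : ℝ) : ℝ :=
  ∫ u in Set.Iic x, Real.exp (-u ^ 2 / 2) / Real.sqrt (2 * Real.pi)

/-- The function `f - g` in factored form. -/
noncomputable def hfun (t C x z : ℝ) : ℝ :=
  z * (z * Real.cos (x * z) - C * Real.sin (x * z)) / (C ^ 2 + z ^ 2) * Real.exp (-t * z ^ 2 / 2)

/-- Dominating antiderivative. -/
noncomputable def nfun (t C x z : ℝ) : ℝ :=
  -((4 + 9 / 2 * (C * x)) / (t * C ^ 2) + (1 + C * x) / C ^ 2 * z ^ 2) * Real.exp (-t * z ^ 2 / 2)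

lemma gauss_int (t : ℝ) (ht : 0 < t) :
    MeasureTheory.Integrable (fun z : ℝ => Real.exp (-t * z ^ 2 / 2)) := by
  have := integrable_exp_neg_mul_sq (b := t / 2) (by positivity)
  refine this.congr (Filter.Eventually.of_forall fun z => ?_)
  simp only
  congr 1; ring

lemma abs_trig_le (C x z : ℝ) (hC : 0 < C) (hx : 0 ≤ x) :
    |z * Real.cos (x * z) - C * Real.sin (x * z)| ≤ |z| * (1 + C * x) := by
  have h1 : |Real.cos (x * z)| ≤ 1 := Real.abs_cos_le_one _
  have h2 : |Real.sin (x * z)| ≤ |x * z| := Real.abs_sin_le_abs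
  calc _ ≤ |z * Real.cos (x * z)| + |C * Real.sin (x * z)| := abs_sub _ _
    _ = |z| * |Real.cos (x * z)| + C * |Real.sin (x * z)| := by
        rw [abs_mul, abs_mul, abs_of_pos hC]
    _ ≤ |z| * 1 + C * |x * z| := by gcongr
    _ = _ := by rw [abs_mul, abs_of_nonneg hx]; ring

lemma abs_hfun_le (t C x z : ℝ) (hC : 0 < C) (hx : 0 ≤ x) :
    |hfun t C x z| ≤ (1 + C * x) * Real.exp (-t * z ^ 2 / 2) := by
  unfold hfun
  have hp : 0 < C ^ 2 + z ^ 2 := by positivity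
  rw [abs_mul, abs_of_pos (Real.exp_pos _), abs_div, abs_of_pos hp]
  gcongr
  rw [div_le_iff₀ hp, abs_mul]
  have := abs_trig_le C x z hC hx
  have h3 : 0 ≤ C * x := by positivity
  calc _ ≤ |z| * (|z| * (1 + C * x)) := by gcongr
    _ = (1 + C * x) * z ^ 2 := by rw [← sq_abs z]; ring
    _ ≤ _ := by gcongr; nlinarith

lemma hfun_cont (t C x : ℝ) (hC : 0 < C) : Continuous (hfun t C x) := by
  unfold hfun
  have : ∀ z : ℝ, C ^ 2 + z ^ 2 ≠ 0 := fun z => by positivity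
  fun_prop (disch := exact this _)

lemma hfun_int (t C x : ℝ) (ht : 0 < t) (hC : 0 < C) (hx : 0 ≤ x) :
    MeasureTheory.Integrable (hfun t C x) :=
  ((gauss_int t ht).const_mul (1 + C * x)).mono' (hfun_cont t C x hC).aestronglyMeasurable
    (Filter.Eventually.of_forall fun z => by
      rw [Real.norm_eq_abs]; exact abs_hfun_le t C x z hC hx)

lemma nfun_deriv (t C x z : ℝ) (ht : 0 < t) (hC : 0 < C) :
    HasDerivAt (nfun t C x)
      (((2 + 5 / 2 * (C * x)) / C ^ 2 * z + (1 + C * x) / C ^ 2 * t * z ^ 3)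
        * Real.exp (-t * z ^ 2 / 2)) z := by
  unfold nfun
  have h1 : HasDerivAt (fun z : ℝ => Real.exp (-t * z ^ 2 / 2))
      (Real.exp (-t * z ^ 2 / 2) * (-t * (2 * z) / 2)) z := by
    have := (((hasDerivAt_pow 2 z).const_mul (-t)).div_const 2).exp
    simpa using this
  have h2 : HasDerivAt (fun z : ℝ =>
      -((4 + 9 / 2 * (C * x)) / (t * C ^ 2) + (1 + C * x) / C ^ 2 * z ^ 2))
      (-((1 + C * x) / C ^ 2 * (2 * z))) z := by
    have := (((hasDerivAt_pow 2 z).const_mul ((1 + C * x) / C ^ 2)).const_add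
      ((4 + 9 / 2 * (C * x)) / (t * C ^ 2))).neg
    refine this.congr_deriv ?_
    norm_num
  refine (h2.mul h1).congr_deriv ?_
  field_simp
  ring

lemma hfun_deriv (t C x z : ℝ) (hC : 0 < C) :
    HasDerivAt (hfun t C x)
      (((C ^ 2 - z ^ 2) / (C ^ 2 + z ^ 2) ^ 2 * (z * Real.cos (x * z) - C * Real.sin (x * z))
        + z / (C ^ 2 + z ^ 2) * ((1 - C * x) * Real.cos (x * z) - x * z * Real.sin (x * z))
        - t * z * (z * (z * Real.cos (x * z) - C * Real.sin (x * z)) / (C ^ 2 + z ^ 2)))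
        * Real.exp (-t * z ^ 2 / 2)) z := by
  unfold hfun
  have hp : C ^ 2 + z ^ 2 ≠ 0 := by positivity
  have h1 : HasDerivAt (fun z : ℝ => Real.exp (-t * z ^ 2 / 2))
      (Real.exp (-t * z ^ 2 / 2) * (-t * (2 * z) / 2)) z := by
    have := (((hasDerivAt_pow 2 z).const_mul (-t)).div_const 2).exp
    simpa using this
  have hl : HasDerivAt (fun z : ℝ => x * z) x z := by
    simpa using (hasDerivAt_id z).const_mul x
  have hc := (hasDerivAt_id z).mul hl.cos
  have hs := hl.sin.const_mul C
  have hn := (hasDerivAt_id z).mul (hc.sub hs)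
  have hd : HasDerivAt (fun z : ℝ => C ^ 2 + z ^ 2) (2 * z) z := by
    simpa using (hasDerivAt_pow 2 z).const_add (C ^ 2)
  have := (hn.div hd hp).mul h1
  refine this.congr_deriv ?_
  simp only [id, Pi.mul_apply, Pi.sub_apply, Pi.div_apply]
  field_simp
  ring

lemma deriv_bound (t C x z : ℝ) (ht : 0 < t) (hC : 0 < C) (hx : 0 ≤ x) (hz : 0 ≤ z) :
    (C ^ 2 - z ^ 2) / (C ^ 2 + z ^ 2) ^ 2 * (z * Real.cos (x * z) - C * Real.sin (x * z))
        + z / (C ^ 2 + z ^ 2) * ((1 - C * x) * Real.cos (x * z) - x * z * Real.sin (x * z))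
        - t * z * (z * (z * Real.cos (x * z) - C * Real.sin (x * z)) / (C ^ 2 + z ^ 2))
      ≤ (2 + 5 / 2 * (C * x)) / C ^ 2 * z + (1 + C * x) / C ^ 2 * t * z ^ 3 := by
  have hp : 0 < C ^ 2 + z ^ 2 := by positivity
  have ha : 0 ≤ C * x := by positivity
  have hq := abs_trig_le C x z hC hx
  rw [abs_of_nonneg hz] at hq
  set q := z * Real.cos (x * z) - C * Real.sin (x * z) with hqd
  have hle : (C ^ 2 + z ^ 2)⁻¹ ≤ (C ^ 2)⁻¹ := by gcongr; nlinarith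
  have e1 : (C ^ 2 - z ^ 2) / (C ^ 2 + z ^ 2) ^ 2 * q ≤ (1 + C * x) / C ^ 2 * z := by
    have : |(C ^ 2 - z ^ 2) / (C ^ 2 + z ^ 2) ^ 2| ≤ (C ^ 2)⁻¹ := by
      refine le_trans ?_ hle
      rw [abs_div, abs_of_pos (pow_pos hp 2), div_le_iff₀ (by positivity)]
      have : (C ^ 2 + z ^ 2)⁻¹ * (C ^ 2 + z ^ 2) ^ 2 = C ^ 2 + z ^ 2 := by field_simp
      rw [this, abs_le]
      constructor <;> nlinarith [sq_nonneg C, sq_nonneg z]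
    calc _ ≤ |(C ^ 2 - z ^ 2) / (C ^ 2 + z ^ 2) ^ 2 * q| := le_abs_self _
      _ = |(C ^ 2 - z ^ 2) / (C ^ 2 + z ^ 2) ^ 2| * |q| := abs_mul _ _
      _ ≤ (C ^ 2)⁻¹ * (z * (1 + C * x)) := by gcongr
      _ = _ := by field_simp
  have e2 : z / (C ^ 2 + z ^ 2) * ((1 - C * x) * Real.cos (x * z)) ≤ (1 + C * x) / C ^ 2 * z := by
    have : (1 - C * x) * Real.cos (x * z) ≤ 1 + C * x := by
      nlinarith [Real.cos_le_one (x * z), Real.neg_one_le_cos (x * z)]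
    calc _ ≤ z / (C ^ 2 + z ^ 2) * (1 + C * x) := by gcongr
      _ = (C ^ 2 + z ^ 2)⁻¹ * (z * (1 + C * x)) := by field_simp
      _ ≤ (C ^ 2)⁻¹ * (z * (1 + C * x)) := by gcongr
      _ = _ := by field_simp
  have e3 : -(z / (C ^ 2 + z ^ 2) * (x * z * Real.sin (x * z))) ≤ 1 / 2 * (C * x) / C ^ 2 * z := by
    have h1 : z / (C ^ 2 + z ^ 2) ≤ 1 / (2 * C) := by
      rw [div_le_div_iff₀ hp (by positivity)]; nlinarith [sq_nonneg (C - z)]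
    have h2 : -(x * z * Real.sin (x * z)) ≤ x * z := by
      nlinarith [Real.neg_one_le_sin (x * z), mul_nonneg hx hz]
    have h3 : 0 ≤ z / (C ^ 2 + z ^ 2) := by positivity
    calc _ = z / (C ^ 2 + z ^ 2) * -(x * z * Real.sin (x * z)) := by ring
      _ ≤ z / (C ^ 2 + z ^ 2) * (x * z) := by gcongr
      _ ≤ 1 / (2 * C) * (x * z) := by gcongr
      _ = _ := by field_simp
  have e4 : -(t * z * (z * q / (C ^ 2 + z ^ 2))) ≤ (1 + C * x) / C ^ 2 * t * z ^ 3 := by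
    have : -q ≤ z * (1 + C * x) := le_trans (neg_le_abs q) hq
    calc _ = t * z * z * (C ^ 2 + z ^ 2)⁻¹ * (-q) := by field_simp
      _ ≤ t * z * z * (C ^ 2 + z ^ 2)⁻¹ * (z * (1 + C * x)) := by gcongr
      _ ≤ t * z * z * (C ^ 2)⁻¹ * (z * (1 + C * x)) := by gcongr
      _ = _ := by field_simp
  have : (2 + 5 / 2 * (C * x)) / C ^ 2 * z = (1 + C * x) / C ^ 2 * z + (1 + C * x) / C ^ 2 * z
    + 1 / 2 * (C * x) / C ^ 2 * z := by ring
  rw [this]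
  linarith [mul_sub (z / (C ^ 2 + z ^ 2)) ((1 - C * x) * Real.cos (x * z)) (x * z * Real.sin (x * z))]

lemma diff_antitone (t C x : ℝ) (ht : 0 < t) (hC : 0 < C) (hx : 0 ≤ x) :
    AntitoneOn (fun z => hfun t C x z - nfun t C x z) (Set.Ici 0) := by
  have hd := fun z => (hfun_deriv t C x z hC).sub (nfun_deriv t C x z ht hC)
  refine antitoneOn_of_deriv_nonpos (convex_Ici 0)
    (fun z _ => (hd z).continuousAt.continuousWithinAt)
    (fun z _ => (hd z).differentiableAt.differentiableWithinAt) ?_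
  intro z hz
  have hz : 0 ≤ z := by simpa using interior_subset hz
  erw [(hd z).deriv]
  rw [← sub_mul]
  exact mul_nonpos_of_nonpos_of_nonneg
    (sub_nonpos.2 (deriv_bound t C x z ht hC hx hz)) (Real.exp_pos _).le

lemma nfun_monotone (t C x : ℝ) (ht : 0 < t) (hC : 0 < C) (hx : 0 ≤ x) :
    MonotoneOn (nfun t C x) (Set.Ici 0) := by
  have hd := fun z => (nfun_deriv t C x z ht hC)
  refine monotoneOn_of_deriv_nonneg (convex_Ici 0)
    (fun z _ => (hd z).continuousAt.continuousWithinAt)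
    (fun z _ => (hd z).differentiableAt.differentiableWithinAt) ?_
  intro z hz
  have hz : 0 ≤ z := by simpa using interior_subset hz
  rw [(hd z).deriv]
  positivity

lemma nfun_nonpos (t C x z : ℝ) (ht : 0 < t) (hC : 0 < C) (hx : 0 ≤ x) : nfun t C x z ≤ 0 := by
  unfold nfun
  refine mul_nonpos_of_nonpos_of_nonneg ?_ (Real.exp_pos _).le
  rw [neg_nonpos]; positivity

lemma step_bound (t C x d : ℝ) (ht : 0 < t) (hC : 0 < C) (hx : 0 ≤ x) (hd : 0 < d) (n : ℕ) :
    d * hfun t C x ((n + 1) * d) ≤ (∫ z in (n * d)..((n + 1) * d), hfun t C x z)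
      + d * (nfun t C x ((n + 1) * d) - nfun t C x (n * d)) := by
  have h0 : (0 : ℝ) ≤ n * d := by positivity
  have hle : (n : ℝ) * d ≤ (n + 1) * d := by nlinarith
  have key : ∫ z in (n * d)..((n + 1) * d), (hfun t C x ((n + 1) * d)
      - (nfun t C x ((n + 1) * d) - nfun t C x (n * d))) ≤
      ∫ z in (n * d)..((n + 1) * d), hfun t C x z := by
    refine intervalIntegral.integral_mono_on hle (by simp)
      ((hfun_cont t C x hC).intervalIntegrable _ _) ?_
    intro z hz
    have a := diff_antitone t C x ht hC hx (a := z) (b := (n + 1) * d)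
      (h0.trans hz.1) (h0.trans hle) hz.2
    have b := nfun_monotone t C x ht hC hx (a := n * d) (b := z) h0 (h0.trans hz.1) hz.1
    simp only at a
    linarith
  rw [intervalIntegral.integral_const, smul_eq_mul] at key
  have : ((n : ℝ) + 1) * d - n * d = d := by ring
  rw [this] at key
  linarith

lemma partial_bound (t C x d : ℝ) (ht : 0 < t) (hC : 0 < C) (hx : 0 ≤ x) (hd : 0 < d) (N : ℕ) :
    d * ∑ n ∈ Finset.range N, hfun t C x ((n + 1) * d) ≤ (∫ z in (0 : ℝ)..(N * d), hfun t C x z)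
      + d * ((4 + 9 / 2 * (C * x)) / (t * C ^ 2)) := by
  have hs : ∀ N : ℕ, d * ∑ n ∈ Finset.range N, hfun t C x ((n + 1) * d)
      ≤ (∫ z in (0 : ℝ)..(N * d), hfun t C x z) + d * (nfun t C x (N * d) - nfun t C x 0) := by
    intro N
    induction N with
    | zero => simp
    | succ k ih =>
      rw [Finset.sum_range_succ, mul_add]
      have h1 := step_bound t C x d ht hC hx hd k
      have h2 := intervalIntegral.integral_add_adjacent_intervals
        ((hfun_cont t C x hC).intervalIntegrable (μ := MeasureTheory.volume) 0 (k * d))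
        ((hfun_cont t C x hC).intervalIntegrable (k * d) ((k + 1) * d))
      push_cast
      linarith
  refine (hs N).trans ?_
  have h1 := nfun_nonpos t C x (N * d) ht hC hx
  have h2 : nfun t C x 0 = -((4 + 9 / 2 * (C * x)) / (t * C ^ 2)) := by simp [nfun]
  rw [h2]
  gcongr
  linarith

lemma hfun_summable (t C x d : ℝ) (ht : 0 < t) (hC : 0 < C) (hx : 0 ≤ x) (hd : 0 < d) :
    Summable (fun n : ℕ => hfun t C x ((n + 1) * d)) := by
  have hs : Summable (fun n : ℕ => (1 + C * x) * Real.exp (n * (-(t * d ^ 2 / 2)))) :=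
    (Real.summable_exp_nat_mul_iff.2 (by rw [neg_lt_zero]; positivity)).mul_left _
  refine Summable.of_norm_bounded hs ?_
  intro n
  refine (abs_hfun_le t C x _ hC hx).trans ?_
  have h3 : 0 ≤ C * x := by positivity
  gcongr
  have : (0 : ℝ) ≤ n := by positivity
  have h4 : 0 ≤ t * d ^ 2 := by positivity
  nlinarith [mul_nonneg h4 this, mul_nonneg h4 (mul_nonneg this this)]

lemma sum_bound (t C x d : ℝ) (ht : 0 < t) (hC : 0 < C) (hx : 0 ≤ x) (hd : 0 < d) :
    d * ∑' n : ℕ, hfun t C x ((n + 1) * d) ≤ (∫ z in Set.Ioi (0 : ℝ), hfun t C x z)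
      + d * ((4 + 9 / 2 * (C * x)) / (t * C ^ 2)) := by
  have h1 := (hfun_summable t C x d ht hC hx hd).hasSum.tendsto_sum_nat.const_mul d
  have h2 := MeasureTheory.intervalIntegral_tendsto_integral_Ioi (l := Filter.atTop)
    (b := fun N : ℕ => (N : ℝ) * d) 0 (hfun_int t C x ht hC hx).integrableOn
    (tendsto_natCast_atTop_atTop.atTop_mul_const hd)
  exact le_of_tendsto_of_tendsto' h1 (h2.add_const _)
    (fun N => partial_bound t C x d ht hC hx hd N)

lemma cos_gauss (t y : ℝ) (ht : 0 < t) :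
    ∫ z : ℝ, Real.cos (y * z) * Real.exp (-t * z ^ 2 / 2)
      = Real.sqrt (2 * π / t) * Real.exp (-y ^ 2 / (2 * t)) := by
  have h := fourierIntegral_gaussian (b := ((t / 2 : ℝ) : ℂ))
    (by rw [Complex.ofReal_re]; positivity) (y : ℂ)
  have hint : MeasureTheory.Integrable (fun z : ℝ => Complex.exp (Complex.I * y * z)
      * Complex.exp (-((t / 2 : ℝ) : ℂ) * z ^ 2)) := by
    have := integrable_cexp_quadratic (b := ((t / 2 : ℝ) : ℂ))
      (by rw [Complex.ofReal_re]; positivity) (Complex.I * y) 0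
    refine this.congr (Filter.Eventually.of_forall fun z => ?_)
    simp only
    rw [← Complex.exp_add]; congr 1; ring
  have h2 := congrArg Complex.re h
  have h3 := (integral_re hint).symm
  simp only [RCLike.re_eq_complex_re] at h3
  rw [h3] at h2
  have hr : ((π : ℂ) / ((t / 2 : ℝ) : ℂ)) ^ (1 / 2 : ℂ) * Complex.exp (-(y : ℂ) ^ 2 / (4 * ((t / 2 : ℝ) : ℂ)))
      = ((Real.sqrt (2 * π / t) * Real.exp (-y ^ 2 / (2 * t)) : ℝ) : ℂ) := by
    rw [Real.sqrt_eq_rpow, Complex.ofReal_mul, Complex.ofReal_cpow (by positivity)]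
    push_cast
    congr 2
    · field_simp
    · field_simp; norm_num
  rw [hr, Complex.ofReal_re] at h2
  rw [← h2]
  congr 1
  ext z
  have : Complex.exp (Complex.I * y * z) * Complex.exp (-((t / 2 : ℝ) : ℂ) * z ^ 2)
     = Complex.exp (((y * z : ℝ) : ℂ) * Complex.I) * ((Real.exp (-t * z ^ 2 / 2) : ℝ) : ℂ) := by
    push_cast
    congr 2 <;> ring
  rw [this, Complex.re_mul_ofReal, Complex.exp_ofReal_mul_I_re]

lemma laplace_int (C : ℝ) (hC : 0 < C) :
    MeasureTheory.IntegrableOn (fun s : ℝ => Real.exp (-C * s)) (Set.Ioi 0) :=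
  exp_neg_integrableOn_Ioi 0 hC

lemma laplace_cos (C x z : ℝ) (hC : 0 < C) :
    ∫ s in Set.Ioi (0 : ℝ), Real.exp (-C * s) * Real.cos ((x - s) * z)
      = (C * Real.cos (x * z) + z * Real.sin (x * z)) / (C ^ 2 + z ^ 2) := by
  have hp : C ^ 2 + z ^ 2 ≠ 0 := by positivity
  have hd : ∀ s : ℝ, HasDerivAt (fun s : ℝ => -Real.exp (-C * s) *
      ((C * Real.cos ((x - s) * z) + z * Real.sin ((x - s) * z)) / (C ^ 2 + z ^ 2)))
      (Real.exp (-C * s) * Real.cos ((x - s) * z)) s := by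
    intro s
    have hl : HasDerivAt (fun s : ℝ => (x - s) * z) (-z) s := by
      simpa using ((hasDerivAt_id s).const_sub x).mul_const z
    have he : HasDerivAt (fun s : ℝ => Real.exp (-C * s)) (Real.exp (-C * s) * (-C)) s := by
      simpa using ((hasDerivAt_id s).const_mul (-C)).exp
    have := he.neg.mul (((hl.cos.const_mul C).add (hl.sin.const_mul z)).div_const (C ^ 2 + z ^ 2))
    refine this.congr_deriv ?_
    simp only [Pi.add_apply, Pi.neg_apply]
    field_simp
    ring
  have hi : MeasureTheory.IntegrableOn
      (fun s : ℝ => Real.exp (-C * s) * Real.cos ((x - s) * z)) (Set.Ioi 0) := by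
    refine MeasureTheory.Integrable.mono' (laplace_int C hC)
      (by fun_prop) (Filter.Eventually.of_forall fun s => ?_)
    rw [norm_mul, Real.norm_eq_abs, Real.norm_eq_abs, abs_of_pos (Real.exp_pos _)]
    exact mul_le_of_le_one_right (Real.exp_pos _).le (Real.abs_cos_le_one _)
  have ht : Filter.Tendsto (fun s : ℝ => -Real.exp (-C * s) *
      ((C * Real.cos ((x - s) * z) + z * Real.sin ((x - s) * z)) / (C ^ 2 + z ^ 2)))
      Filter.atTop (nhds 0) := by
    have hE : Filter.Tendsto (fun s : ℝ => Real.exp (-C * s) * ((C + |z|) / (C ^ 2 + z ^ 2)))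
        Filter.atTop (nhds 0) := by
      rw [show (0 : ℝ) = 0 * ((C + |z|) / (C ^ 2 + z ^ 2)) by ring]
      refine Filter.Tendsto.mul_const _ (Real.tendsto_exp_atBot.comp ?_)
      exact Filter.tendsto_id.const_mul_atTop_of_neg (by linarith)
    refine squeeze_zero_norm (fun s => ?_) hE
    rw [norm_mul, norm_neg, Real.norm_eq_abs, Real.norm_eq_abs, abs_of_pos (Real.exp_pos _),
      abs_div, abs_of_pos (show 0 < C ^ 2 + z ^ 2 by positivity)]
    gcongr
    refine (abs_add_le _ _).trans ?_
    rw [abs_mul, abs_mul, abs_of_pos hC]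
    have := Real.abs_cos_le_one ((x - s) * z)
    have := Real.abs_sin_le_one ((x - s) * z)
    nlinarith [abs_nonneg z]
  rw [MeasureTheory.integral_Ioi_of_hasDerivAt_of_tendsto' (fun s _ => hd s) hi ht]
  simp

lemma fubini_part (t C x : ℝ) (ht : 0 < t) (hC : 0 < C) :
    ∫ z : ℝ, (C * Real.cos (x * z) + z * Real.sin (x * z)) / (C ^ 2 + z ^ 2)
        * Real.exp (-t * z ^ 2 / 2)
      = ∫ s in Set.Ioi (0 : ℝ), Real.exp (-C * s) *
          (Real.sqrt (2 * π / t) * Real.exp (-(x - s) ^ 2 / (2 * t))) := by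
  have hprod : MeasureTheory.Integrable (Function.uncurry (fun (z s : ℝ) =>
      Real.exp (-C * s) * Real.cos ((x - s) * z) * Real.exp (-t * z ^ 2 / 2)))
      (MeasureTheory.volume.prod (MeasureTheory.volume.restrict (Set.Ioi 0))) := by
    refine MeasureTheory.Integrable.mono' ((gauss_int t ht).mul_prod (laplace_int C hC))
      ?_ (Filter.Eventually.of_forall fun p => ?_)
    · apply Continuous.aestronglyMeasurable
      unfold Function.uncurry
      fun_prop
    · simp only [Function.uncurry]
      rw [norm_mul, norm_mul, Real.norm_eq_abs, Real.norm_eq_abs, Real.norm_eq_abs,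
        abs_of_pos (Real.exp_pos _), abs_of_pos (Real.exp_pos _), mul_comm]
      gcongr
      exact mul_le_of_le_one_right (Real.exp_pos _).le (Real.abs_cos_le_one _)
  have := MeasureTheory.integral_integral_swap hprod
  simp only [MeasureTheory.integral_mul_const, laplace_cos C x _ hC] at this
  rw [this]
  congr 1
  ext s
  rw [← cos_gauss t (x - s) ht, ← MeasureTheory.integral_const_mul]
  congr 1
  ext z
  ring

lemma shift_Ioi (g : ℝ → ℝ) (m : ℝ) :
    ∫ u in Set.Ioi (0 : ℝ), g (u + m) = ∫ u in Set.Ioi m, g u := by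
  have := (MeasureTheory.measurePreserving_add_right MeasureTheory.volume m).setIntegral_preimage_emb
    (measurableEmbedding_addRight m) g (Set.Ioi m)
  rw [← this]
  congr 2
  ext u; simp

lemma tail_eq (m : ℝ) :
    ∫ u in Set.Ioi m, Real.exp (-u ^ 2 / 2) = Real.sqrt (2 * π) * (1 - stdNormalCDF m) := by
  have hi : MeasureTheory.Integrable (fun u : ℝ => Real.exp (-u ^ 2 / 2)) := by
    simpa using gauss_int 1 one_pos
  have h1 := intervalIntegral.integral_Iic_add_Ioi (b := m) hi.integrableOn hi.integrableOn
  have h2 : ∫ u : ℝ, Real.exp (-u ^ 2 / 2) = Real.sqrt (2 * π) := by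
    have := integral_gaussian (1 / 2)
    rw [show π / (1 / 2) = 2 * π by ring] at this
    rw [← this]
    congr 1; ext u; congr 1; ring
  unfold stdNormalCDF
  rw [MeasureTheory.integral_div]
  have : Real.sqrt (2 * π) ≠ 0 := by positivity
  rw [mul_sub, mul_div_cancel₀ _ this]
  linarith

lemma gauss_tail (t C x : ℝ) (ht : 0 < t) :
    ∫ s in Set.Ioi (0 : ℝ), Real.exp (-C * s) *
          (Real.sqrt (2 * π / t) * Real.exp (-(x - s) ^ 2 / (2 * t)))
      = 2 * π * Real.exp (-(C * x - C ^ 2 * t / 2)) *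
        (1 - stdNormalCDF (Real.sqrt t * C - x / Real.sqrt t)) := by
  set m := Real.sqrt t * C - x / Real.sqrt t with hm
  have hr : 0 < Real.sqrt t := Real.sqrt_pos.2 ht
  have hrr : Real.sqrt t ^ 2 = t := Real.sq_sqrt ht.le
  have e : ∀ s : ℝ, Real.exp (-C * s) *
          (Real.sqrt (2 * π / t) * Real.exp (-(x - s) ^ 2 / (2 * t)))
      = (Real.sqrt (2 * π / t) * Real.exp (-(C * x - C ^ 2 * t / 2))) *
        Real.exp (-((Real.sqrt t)⁻¹ * s + m) ^ 2 / 2) := by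
    intro s
    rw [mul_left_comm, mul_assoc, ← Real.exp_add, ← Real.exp_add]
    congr 2
    rw [hm]
    generalize Real.sqrt t = r at *
    subst hrr
    field_simp
    ring
  simp_rw [e]
  rw [MeasureTheory.integral_const_mul,
    MeasureTheory.integral_comp_mul_left_Ioi (fun u => Real.exp (-(u + m) ^ 2 / 2)) 0
      (inv_pos.2 hr), mul_zero, shift_Ioi (fun u => Real.exp (-u ^ 2 / 2)), tail_eq, inv_inv,
    smul_eq_mul, Real.sqrt_div (by positivity)]
  have : Real.sqrt (2 * π) ^ 2 = 2 * π := Real.sq_sqrt (by positivity)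
  have h0 : Real.sqrt (2 * π) ≠ 0 := by positivity
  generalize Real.sqrt (2 * π) = w at *
  field_simp
  rw [this]
  ring

lemma hfun_integral (t C x : ℝ) (ht : 0 < t) (hC : 0 < C) (hx : 0 ≤ x) :
    2 * ∫ z in Set.Ioi (0 : ℝ), hfun t C x z
      = Real.sqrt (2 * π / t) * Real.exp (-x ^ 2 / (2 * t))
        - C * (2 * π * Real.exp (-(C * x - C ^ 2 * t / 2)) *
        (1 - stdNormalCDF (Real.sqrt t * C - x / Real.sqrt t))) := by
  have hev : ∀ z, hfun t C x |z| = hfun t C x z := by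
    intro z
    rcases abs_cases z with ⟨h, _⟩ | ⟨h, _⟩ <;> rw [h]
    simp [hfun]; ring
  rw [← integral_comp_abs]
  simp_rw [hev]
  rw [← gauss_tail t C x ht, ← fubini_part t C x ht hC, ← cos_gauss t x ht,
    ← MeasureTheory.integral_const_mul]
  have hi1 : MeasureTheory.Integrable
      (fun z : ℝ => Real.cos (x * z) * Real.exp (-t * z ^ 2 / 2)) := by
    refine (gauss_int t ht).mono' (by fun_prop) (Filter.Eventually.of_forall fun z => ?_)
    rw [norm_mul, Real.norm_eq_abs, Real.norm_eq_abs, abs_of_pos (Real.exp_pos _)]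
    exact mul_le_of_le_one_left (Real.exp_pos _).le (Real.abs_cos_le_one _)
  have he : ∀ z : ℝ, C * ((C * Real.cos (x * z) + z * Real.sin (x * z)) / (C ^ 2 + z ^ 2)
        * Real.exp (-t * z ^ 2 / 2)) = Real.cos (x * z) * Real.exp (-t * z ^ 2 / 2) - hfun t C x z := by
    intro z
    have hp : C ^ 2 + z ^ 2 ≠ 0 := by positivity
    unfold hfun
    field_simp
    ring
  simp_rw [he]
  rw [MeasureTheory.integral_sub hi1 (hfun_int t C x ht hC hx)]
  ring

theorem transition_density_bound (t C l x : ℝ) (ht : 0 < t) (hC : 0 < C) (hl : 0 < l)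
    (hx : x ∈ Set.Icc (0 : ℝ) l)
    (f g : ℝ → ℝ)
    (hf : f = fun z => z ^ 2 * Real.cos (x * z) / (C ^ 2 + z ^ 2) * Real.exp (-t * z ^ 2 / 2))
    (hg : g = fun z => C * z * Real.sin (x * z) / (C ^ 2 + z ^ 2) * Real.exp (-t * z ^ 2 / 2))
    (p : ℝ)
    (hp : p = 2 * C / (1 - Real.exp (-2 * C * l)) +
      Real.exp (C * x - C ^ 2 * t / 2) * (2 / l) *
        ∑' n : ℕ, (f ((n + 1) * Real.pi / l) - g ((n + 1) * Real.pi / l))) :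
    p ≤ 2 * C * Real.exp (-2 * C * l) / (1 - Real.exp (-2 * C * l)) +
        (2 / Real.sqrt t) * stdNormalPDF (Real.sqrt t * C - x / Real.sqrt t) +
        2 * C * stdNormalCDF (Real.sqrt t * C - x / Real.sqrt t) +
        2 * Real.exp (C * x - C ^ 2 * t / 2) * (3 + x * C) ^ 2 / (l * t * C ^ 2) := by
  have hx0 : 0 ≤ x := hx.1
  have hsum : ∀ n : ℕ, f ((n + 1) * Real.pi / l) - g ((n + 1) * Real.pi / l)
      = hfun t C x ((n + 1) * (π / l)) := by
    intro n
    rw [hf, hg, mul_div_assoc]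
    unfold hfun
    ring
  simp_rw [hsum] at hp
  have hb := sum_bound t C x (π / l) ht hC hx0 (by positivity)
  have hI := hfun_integral t C x ht hC hx0
  set S := ∑' n : ℕ, hfun t C x ((n + 1) * (π / l)) with hS
  set J := ∫ z in Set.Ioi (0 : ℝ), hfun t C x z with hJ
  set m := Real.sqrt t * C - x / Real.sqrt t with hm
  set A := Real.exp (C * x - C ^ 2 * t / 2) with hA
  have hApos : 0 < A := Real.exp_pos _
  have hE : Real.exp (-2 * C * l) < 1 := by
    rw [Real.exp_lt_one_iff]; nlinarith [mul_pos hC hl]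
  have h1 : 2 * C / (1 - Real.exp (-2 * C * l))
      = 2 * C + 2 * C * Real.exp (-2 * C * l) / (1 - Real.exp (-2 * C * l)) := by
    have : 1 - Real.exp (-2 * C * l) ≠ 0 := by linarith
    generalize Real.exp (-2 * C * l) = e at *
    field_simp
    ring
  have h2 : A * (2 / l) * S ≤ A * (2 / π) * J + A * (2 / l) * ((4 + 9 / 2 * (C * x)) / (t * C ^ 2)) := by
    have := mul_le_mul_of_nonneg_left hb (show 0 ≤ A * (2 / π) by positivity)
    calc _ = A * (2 / π) * (π / l * S) := by field_simp
      _ ≤ _ := this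
      _ = _ := by field_simp
  have h3 : A * (2 / l) * ((4 + 9 / 2 * (C * x)) / (t * C ^ 2))
      ≤ 2 * A * (3 + x * C) ^ 2 / (l * t * C ^ 2) := by
    have : 4 + 9 / 2 * (C * x) ≤ (3 + x * C) ^ 2 := by nlinarith [mul_nonneg hC.le hx0]
    calc _ ≤ A * (2 / l) * ((3 + x * C) ^ 2 / (t * C ^ 2)) := by gcongr
      _ = _ := by field_simp
  have h4 : A * (2 / π) * J = (2 / Real.sqrt t) * stdNormalPDF m - 2 * C * (1 - stdNormalCDF m) := by
    have hr : 0 < Real.sqrt t := Real.sqrt_pos.2 ht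
    have hrr : Real.sqrt t ^ 2 = t := Real.sq_sqrt ht.le
    have ha1 : A * Real.exp (-(C * x - C ^ 2 * t / 2)) = 1 := by
      rw [hA, ← Real.exp_add]; simp
    have ha2 : A * Real.exp (-x ^ 2 / (2 * t)) = Real.exp (-m ^ 2 / 2) := by
      rw [hA, ← Real.exp_add, hm]
      congr 1
      generalize Real.sqrt t = r at *
      subst hrr
      field_simp
      ring
    have hs : Real.sqrt (2 * π) ^ 2 = 2 * π := Real.sq_sqrt (by positivity)
    have hs0 : Real.sqrt (2 * π) ≠ 0 := by positivity
    calc A * (2 / π) * J = A * (1 / π) * (2 * J) := by ring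
      _ = 1 / π * Real.sqrt (2 * π / t) * (A * Real.exp (-x ^ 2 / (2 * t)))
          - 2 * C * (A * Real.exp (-(C * x - C ^ 2 * t / 2))) * (1 - stdNormalCDF m) := by
          rw [hI]; field_simp
      _ = _ := by
          rw [ha1, ha2, Real.sqrt_div (by positivity)]
          unfold stdNormalPDF
          have : 1 / π * (Real.sqrt (2 * π) / Real.sqrt t) = 2 / Real.sqrt t / Real.sqrt (2 * π) := by
            generalize Real.sqrt (2 * π) = w at *
            field_simp
            linarith
          rw [this]
          ring
  rw [hp, h1]
  linarith
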